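/- If p is a well-typed program of λFv (a closed plain term typable in empty environments), then the call-by-value evaluation of p terminates: there exists a value v such that p →v* v. -/

import Mathlib

/-!
Language `λFv`: explicitly typed System F extended with the abortive control
operator `callcc` and a `throw` construct, in de Bruijn representation
(separate de Bruijn indices for term variables, continuation variables and
type variables).
-/

namespace LambdaFv

/-- Types of System F: type variables (de Bruijn), arrow types, universal types. -/
inductive Ty : Type where
  | var : Nat → Ty
  | arrow : Ty → Ty → Ty
  | all : Ty → Ty

/-- Lifting of a renaming under a binder. -/
def liftRen (ρ : Nat → Nat) : Nat → Nat
  | 0 => 0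
  | n+1 => ρ n + 1

/-- Renaming of type variables in a type. -/
def renTy (ρ : Nat → Nat) : Ty → Ty
  | .var n => .var (ρ n)
  | .arrow a b => .arrow (renTy ρ a) (renTy ρ b)
  | .all a => .all (renTy (liftRen ρ) a)

/-- Lifting of a type substitution under a type binder. -/
def liftTySub (σ : Nat → Ty) : Nat → Ty
  | 0 => .var 0
  | n+1 => renTy Nat.succ (σ n)

/-- Simultaneous substitution of types for type variables in a type. -/
def subTy (σ : Nat → Ty) : Ty → Ty
  | .var n => σ n
  | .arrow a b => .arrow (subTy σ a) (subTy σ b)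
  | .all a => .all (subTy (liftTySub σ) a)

/-- `subTy0 U S` is `S[α₀ := U]` (instantiation of the type variable 0). -/
def subTy0 (U : Ty) (S : Ty) : Ty :=
  subTy (fun n => match n with | 0 => U | n+1 => .var n) S

/-- `subTyList Ts S` is `S[ᾱ := Ts]`: simultaneous substitution of the types
`Ts` for the free type variables of `S`. -/
def subTyList (Ts : List Ty) (S : Ty) : Ty :=
  subTy (fun n => Ts.getD n (.var n)) S

/-- `ScopedTy p S`: all free type variables of `S` are among `α₀,…,α_{p-1}`. -/
inductive ScopedTy : Nat → Ty → Prop where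
  | var : ∀ {p n}, n < p → ScopedTy p (.var n)
  | arrow : ∀ {p a b}, ScopedTy p a → ScopedTy p b → ScopedTy p (.arrow a b)
  | all : ∀ {p a}, ScopedTy (p+1) a → ScopedTy p (.all a)

/-- A closed type: no free type variables. -/
def ClosedTy (S : Ty) : Prop := ScopedTy 0 S

mutual
/-- Terms of `λFv`:
variables, `λx:S.t`, application, `Λα.t`, type application, `K k.t` (callcc),
`k ← t` (throw to a continuation variable), `⌈E⌉ ← t` (throw to a reified context). -/
inductive Tm : Type where
  | var : Nat → Tm
  | lam : Ty → Tm → Tm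
  | app : Tm → Tm → Tm
  | tlam : Tm → Tm
  | tapp : Tm → Ty → Tm
  | callcc : Tm → Tm
  | throwVar : Nat → Tm → Tm
  | throwCtx : Ctx → Tm → Tm

/-- Call-by-value evaluation contexts, represented inside-out:
`[]`, `(λx:S.t)·E`, `E t`, `E S`, `⌈E₀⌉ ← E`. -/
inductive Ctx : Type where
  | hole : Ctx
  | lamApp : Ty → Tm → Ctx → Ctx
  | app : Ctx → Tm → Ctx
  | tapp : Ctx → Ty → Ctx
  | throw : Ctx → Ctx → Ctx
end

/-- Plugging a term in a context (contexts are represented inside-out). -/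
def plug : Tm → Ctx → Tm
  | t, .hole => t
  | t, .lamApp S b E => plug (.app (.lam S b) t) E
  | t, .app E u => plug (.app t u) E
  | t, .tapp E S => plug (.tapp t S) E
  | t, .throw E0 E => plug (.throwCtx E0 t) E

/-- Values: λ-abstractions and Λ-abstractions. -/
inductive IsValue : Tm → Prop where
  | lam : ∀ {S t}, IsValue (.lam S t)
  | tlam : ∀ {t}, IsValue (.tlam t)

/-- Plain terms: terms with no subterm of the form `⌈E⌉ ← t`. -/
inductive Plain : Tm → Prop where
  | var : ∀ {n}, Plain (.var n)
  | lam : ∀ {S t}, Plain t → Plain (.lam S t)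
  | app : ∀ {a b}, Plain a → Plain b → Plain (.app a b)
  | tlam : ∀ {t}, Plain t → Plain (.tlam t)
  | tapp : ∀ {t S}, Plain t → Plain (.tapp t S)
  | callcc : ∀ {t}, Plain t → Plain (.callcc t)
  | throwVar : ∀ {k t}, Plain t → Plain (.throwVar k t)

mutual
/-- `ScTm n m p t`: the free term variables of `t` are `< n`, its free
continuation variables are `< m` and its free type variables are `< p`. -/
inductive ScTm : Nat → Nat → Nat → Tm → Prop where
  | var : ∀ {n m p x}, x < n → ScTm n m p (.var x)
  | lam : ∀ {n m p S t}, ScopedTy p S → ScTm (n+1) m p t → ScTm n m p (.lam S t)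
  | app : ∀ {n m p a b}, ScTm n m p a → ScTm n m p b → ScTm n m p (.app a b)
  | tlam : ∀ {n m p t}, ScTm n m (p+1) t → ScTm n m p (.tlam t)
  | tapp : ∀ {n m p t S}, ScTm n m p t → ScopedTy p S → ScTm n m p (.tapp t S)
  | callcc : ∀ {n m p t}, ScTm n (m+1) p t → ScTm n m p (.callcc t)
  | throwVar : ∀ {n m p k t}, k < m → ScTm n m p t → ScTm n m p (.throwVar k t)
  | throwCtx : ∀ {n m p E t}, ScCtx n m p E → ScTm n m p t → ScTm n m p (.throwCtx E t)

/-- Scoping predicate for contexts. -/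
inductive ScCtx : Nat → Nat → Nat → Ctx → Prop where
  | hole : ∀ {n m p}, ScCtx n m p .hole
  | lamApp : ∀ {n m p S t E}, ScopedTy p S → ScTm (n+1) m p t → ScCtx n m p E →
      ScCtx n m p (.lamApp S t E)
  | app : ∀ {n m p E t}, ScCtx n m p E → ScTm n m p t → ScCtx n m p (.app E t)
  | tapp : ∀ {n m p E S}, ScCtx n m p E → ScopedTy p S → ScCtx n m p (.tapp E S)
  | throw : ∀ {n m p E0 E1}, ScCtx n m p E0 → ScCtx n m p E1 → ScCtx n m p (.throw E0 E1)
end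

/-- A closed term: no free variables of any kind. -/
def ClosedTm (t : Tm) : Prop := ScTm 0 0 0 t

/-- A closed context: no free variables of any kind. -/
def ClosedCtx (E : Ctx) : Prop := ScCtx 0 0 0 E

mutual
/-- Renaming of the three kinds of variables in terms. -/
def renTm (ρx ρk ρa : Nat → Nat) : Tm → Tm
  | .var n => .var (ρx n)
  | .lam S t => .lam (renTy ρa S) (renTm (liftRen ρx) ρk ρa t)
  | .app a b => .app (renTm ρx ρk ρa a) (renTm ρx ρk ρa b)
  | .tlam t => .tlam (renTm ρx ρk (liftRen ρa) t)
  | .tapp t S => .tapp (renTm ρx ρk ρa t) (renTy ρa S)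
  | .callcc t => .callcc (renTm ρx (liftRen ρk) ρa t)
  | .throwVar k t => .throwVar (ρk k) (renTm ρx ρk ρa t)
  | .throwCtx E t => .throwCtx (renCtx ρx ρk ρa E) (renTm ρx ρk ρa t)

/-- Renaming of the three kinds of variables in contexts. -/
def renCtx (ρx ρk ρa : Nat → Nat) : Ctx → Ctx
  | .hole => .hole
  | .lamApp S t E => .lamApp (renTy ρa S) (renTm (liftRen ρx) ρk ρa t) (renCtx ρx ρk ρa E)
  | .app E t => .app (renCtx ρx ρk ρa E) (renTm ρx ρk ρa t)
  | .tapp E S => .tapp (renCtx ρx ρk ρa E) (renTy ρa S)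
  | .throw E0 E => .throw (renCtx ρx ρk ρa E0) (renCtx ρx ρk ρa E)
end

/-- An entry of a continuation substitution: either a reified context or a
continuation variable. -/
def mapKEnt (f : Ctx → Ctx) : Ctx ⊕ Nat → Ctx ⊕ Nat
  | .inl E => .inl (f E)
  | .inr n => .inr n

/-- Lifting of a term substitution under a term binder. -/
def liftSubX (σ : Nat → Tm) : Nat → Tm
  | 0 => .var 0
  | n+1 => renTm Nat.succ id id (σ n)

/-- Shifting of a term substitution under a continuation binder. -/
def shiftSubXk (σ : Nat → Tm) : Nat → Tm := fun n => renTm id Nat.succ id (σ n)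

/-- Shifting of a term substitution under a type binder. -/
def shiftSubXa (σ : Nat → Tm) : Nat → Tm := fun n => renTm id id Nat.succ (σ n)

/-- Lifting of a continuation substitution under a continuation binder. -/
def liftSubK (σ : Nat → Ctx ⊕ Nat) : Nat → Ctx ⊕ Nat
  | 0 => .inr 0
  | n+1 =>
    match σ n with
    | .inl E => .inl (renCtx id Nat.succ id E)
    | .inr m => .inr (m+1)

/-- Shifting of a continuation substitution under a term binder. -/
def shiftSubKx (σ : Nat → Ctx ⊕ Nat) : Nat → Ctx ⊕ Nat :=
  fun n => mapKEnt (renCtx Nat.succ id id) (σ n)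

/-- Shifting of a continuation substitution under a type binder. -/
def shiftSubKa (σ : Nat → Ctx ⊕ Nat) : Nat → Ctx ⊕ Nat :=
  fun n => mapKEnt (renCtx id id Nat.succ) (σ n)

mutual
/-- Simultaneous capture-avoiding substitution in terms: `σx` substitutes terms for
term variables, `σk` substitutes reified contexts for continuation variables,
`σa` substitutes types for type variables. -/
def subTm (σx : Nat → Tm) (σk : Nat → Ctx ⊕ Nat) (σa : Nat → Ty) : Tm → Tm
  | .var n => σx n
  | .lam S t => .lam (subTy σa S) (subTm (liftSubX σx) (shiftSubKx σk) σa t)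
  | .app a b => .app (subTm σx σk σa a) (subTm σx σk σa b)
  | .tlam t => .tlam (subTm (shiftSubXa σx) (shiftSubKa σk) (liftTySub σa) t)
  | .tapp t S => .tapp (subTm σx σk σa t) (subTy σa S)
  | .callcc t => .callcc (subTm (shiftSubXk σx) (liftSubK σk) σa t)
  | .throwVar k t =>
    match σk k with
    | .inl E => .throwCtx E (subTm σx σk σa t)
    | .inr m => .throwVar m (subTm σx σk σa t)
  | .throwCtx E t => .throwCtx (subCtx σx σk σa E) (subTm σx σk σa t)

/-- Simultaneous capture-avoiding substitution in contexts. -/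
def subCtx (σx : Nat → Tm) (σk : Nat → Ctx ⊕ Nat) (σa : Nat → Ty) : Ctx → Ctx
  | .hole => .hole
  | .lamApp S t E => .lamApp (subTy σa S) (subTm (liftSubX σx) (shiftSubKx σk) σa t) (subCtx σx σk σa E)
  | .app E t => .app (subCtx σx σk σa E) (subTm σx σk σa t)
  | .tapp E S => .tapp (subCtx σx σk σa E) (subTy σa S)
  | .throw E0 E => .throw (subCtx σx σk σa E0) (subCtx σx σk σa E)
end

/-- `sub0X v t` is `t[x₀ := v]`. -/
def sub0X (v : Tm) (t : Tm) : Tm :=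
  subTm (fun n => match n with | 0 => v | n+1 => .var n) Sum.inr Ty.var t

/-- `sub0A S t` is `t[α₀ := S]`. -/
def sub0A (S : Ty) (t : Tm) : Tm :=
  subTm Tm.var Sum.inr (fun n => match n with | 0 => S | n+1 => .var n) t

/-- `sub0K E t` is `t[k₀ := ⌈E⌉]`. -/
def sub0K (E : Ctx) (t : Tm) : Tm :=
  subTm Tm.var (fun n => match n with | 0 => .inl E | n+1 => .inr n) Ty.var t

/-- `msub Vs vs Es t` is the simultaneous substitution
`t[ᾱ := Vs][x̄ := vs][k̄ := ⌈Es⌉]`. -/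
def msub (Vs : List Ty) (vs : List Tm) (Es : List Ctx) (t : Tm) : Tm :=
  subTm (fun n => vs.getD n (.var n))
        (fun n => match Es[n]? with | some E => .inl E | none => .inr n)
        (fun n => Vs.getD n (.var n)) t

mutual
/-- The type system of Figure 1: typing of terms, `Γ;Δ ⊢ t : S`.
`Γ` assigns types to term variables; `Δ` assigns context types `¬S`
(represented by their hole type `S`) to continuation variables. -/
inductive HasTy : List Ty → List Ty → Tm → Ty → Prop where
  | var : ∀ {Γ Δ x S}, Γ[x]? = some S → HasTy Γ Δ (.var x) S
  | lam : ∀ {Γ Δ S T t}, HasTy (S::Γ) Δ t T → HasTy Γ Δ (.lam S t) (.arrow S T)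
  | app : ∀ {Γ Δ S T t0 t1}, HasTy Γ Δ t0 (.arrow S T) → HasTy Γ Δ t1 S →
      HasTy Γ Δ (.app t0 t1) T
  | tlam : ∀ {Γ Δ t S}, HasTy (Γ.map (renTy Nat.succ)) (Δ.map (renTy Nat.succ)) t S →
      HasTy Γ Δ (.tlam t) (.all S)
  | tapp : ∀ {Γ Δ t S T}, HasTy Γ Δ t (.all S) → HasTy Γ Δ (.tapp t T) (subTy0 T S)
  | callcc : ∀ {Γ Δ t S}, HasTy Γ (S::Δ) t S → HasTy Γ Δ (.callcc t) S
  | throwVar : ∀ {Γ Δ k t S T}, Δ[k]? = some S → HasTy Γ Δ t S →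
      HasTy Γ Δ (.throwVar k t) T
  | throwCtx : ∀ {Γ Δ E t S T}, HasTyCtx Γ Δ E S → HasTy Γ Δ t S →
      HasTy Γ Δ (.throwCtx E t) T

/-- The type system of Figure 1: typing of contexts, `Γ;Δ ⊢ E : ¬S`. -/
inductive HasTyCtx : List Ty → List Ty → Ctx → Ty → Prop where
  | hole : ∀ {Γ Δ S}, HasTyCtx Γ Δ .hole S
  | lamApp : ∀ {Γ Δ S T t E}, HasTy Γ Δ (.lam S t) (.arrow S T) → HasTyCtx Γ Δ E T →
      HasTyCtx Γ Δ (.lamApp S t E) S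
  | app : ∀ {Γ Δ S T t E}, HasTy Γ Δ t S → HasTyCtx Γ Δ E T →
      HasTyCtx Γ Δ (.app E t) (.arrow S T)
  | tapp : ∀ {Γ Δ S T E}, HasTyCtx Γ Δ E (subTy0 T S) → HasTyCtx Γ Δ (.tapp E T) (.all S)
  | throw : ∀ {Γ Δ S T E0 E1}, HasTyCtx Γ Δ E0 S → HasTyCtx Γ Δ E1 T →
      HasTyCtx Γ Δ (.throw E0 E1) S
end

/-- The call-by-value one-step reduction relation `→v` of `λFv`. -/
inductive Step : Tm → Tm → Prop where
  | beta : ∀ {S t v E}, IsValue v →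
      Step (plug (.app (.lam S t) v) E) (plug (sub0X v t) E)
  | betaT : ∀ {t S E},
      Step (plug (.tapp (.tlam t) S) E) (plug (sub0A S t) E)
  | callcc : ∀ {t E},
      Step (plug (.callcc t) E) (plug (sub0K E t) E)
  | throw : ∀ {E0 E1 v}, IsValue v →
      Step (plug (.throwCtx E0 v) E1) (plug v E0)

/-- Call-by-value evaluation: the reflexive-transitive closure of `→v`. -/
def Steps : Tm → Tm → Prop := Relation.ReflTransGen Step

/-- Redexes of `λFv` under call by value. -/
inductive IsRedex : Tm → Prop where
  | beta : ∀ {S t v}, IsValue v → IsRedex (.app (.lam S t) v)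
  | betaT : ∀ {t S}, IsRedex (.tapp (.tlam t) S)
  | callcc : ∀ {t}, IsRedex (.callcc t)
  | throw : ∀ {E v}, IsValue v → IsRedex (.throwCtx E v)

/-- `Norm p`: the program `p` evaluates to a value. -/
def Norm (p : Tm) : Prop := ∃ v, IsValue v ∧ Steps p v

/-- A reducibility candidate of type `S` is a set of closed values of type `S`. -/
def IsCand (S : Ty) (R : Set Tm) : Prop :=
  ∀ v ∈ R, IsValue v ∧ ClosedTm v ∧ HasTy [] [] v S

/-- `CtxOK R E` is the predicate `R ⊨ E`, i.e. `∀ v ∈ R, norm (E[v])`. -/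
def CtxOK (R : Set Tm) (E : Ctx) : Prop := ∀ v ∈ R, Norm (plug v E)

/-- `CtxAdm A R E`: `E` is a closed context of type `¬A` with `R ⊨ E`. -/
def CtxAdm (A : Ty) (R : Set Tm) (E : Ctx) : Prop :=
  ClosedCtx E ∧ HasTyCtx [] [] E A ∧ CtxOK R E

/-- The parametric reducibility candidate `RED_S(ᾱ ↦ R̄)` (call by value),
defined by induction on `S`.  `Ts` are the types of the candidates `Rs`. -/
def RED : Ty → List Ty → List (Set Tm) → Set Tm
  | .var i, _, Rs => Rs.getD i ∅
  | .arrow S1 S2, Ts, Rs =>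
      {v0 | IsValue v0 ∧ ClosedTm v0 ∧ HasTy [] [] v0 (subTyList Ts (.arrow S1 S2)) ∧
        ∀ v1 ∈ RED S1 Ts Rs, ∀ E, CtxAdm (subTyList Ts S2) (RED S2 Ts Rs) E →
          Norm (plug (.app v0 v1) E)}
  | .all S, Ts, Rs =>
      {v | IsValue v ∧ ClosedTm v ∧ HasTy [] [] v (subTyList Ts (.all S)) ∧
        ∀ (U : Ty) (Rc : Set Tm), IsCand U Rc →
          ∀ E, CtxAdm (subTyList (U::Ts) S) (RED S (U::Ts) (Rc::Rs)) E →
            Norm (plug (.tapp v U) E)}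

end LambdaFv
namespace LambdaFv

/-! ### Substitution algebra -/

theorem liftRen_comp (ρ' ρ : Nat → Nat) : liftRen (ρ' ∘ ρ) = liftRen ρ' ∘ liftRen ρ := by
  funext n; cases n <;> rfl

theorem renTy_renTy (S : Ty) : ∀ ρ' ρ, renTy ρ' (renTy ρ S) = renTy (ρ' ∘ ρ) S := by
  induction S with
  | var n => intros; rfl
  | arrow a b iha ihb => intros; simp [renTy, iha, ihb]
  | all a ih => intros; simp [renTy, ih, liftRen_comp]

theorem liftTySub_comp_ren (σ : Nat → Ty) (ρ : Nat → Nat) :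
    liftTySub (σ ∘ ρ) = liftTySub σ ∘ liftRen ρ := by
  funext n; cases n <;> rfl

theorem subTy_renTy (S : Ty) : ∀ σ ρ, subTy σ (renTy ρ S) = subTy (σ ∘ ρ) S := by
  induction S with
  | var n => intros; rfl
  | arrow a b iha ihb => intros; simp [renTy, subTy, iha, ihb]
  | all a ih => intros; simp [renTy, subTy, ih, liftTySub_comp_ren]

theorem liftTySub_renTy (ρ : Nat → Nat) (σ : Nat → Ty) :
    liftTySub (fun n => renTy ρ (σ n)) = fun n => renTy (liftRen ρ) (liftTySub σ n) := by
  funext n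
  cases n with
  | zero => rfl
  | succ n => simp only [liftTySub, renTy_renTy]; rfl

theorem renTy_subTy (S : Ty) :
    ∀ ρ σ, renTy ρ (subTy σ S) = subTy (fun n => renTy ρ (σ n)) S := by
  induction S with
  | var n => intros; rfl
  | arrow a b iha ihb => intros; simp [renTy, subTy, iha, ihb]
  | all a ih => intros; simp [renTy, subTy, ih, liftTySub_renTy]

theorem liftTySub_subTy (τ σ : Nat → Ty) :
    liftTySub (fun n => subTy τ (σ n)) = fun n => subTy (liftTySub τ) (liftTySub σ n) := by
  funext n
  cases n with
  | zero => rfl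
  | succ n => simp only [liftTySub, renTy_subTy, subTy_renTy]; rfl

theorem subTy_subTy (S : Ty) :
    ∀ τ σ, subTy τ (subTy σ S) = subTy (fun n => subTy τ (σ n)) S := by
  induction S with
  | var n => intros; rfl
  | arrow a b iha ihb => intros; simp [subTy, iha, ihb]
  | all a ih => intros; simp [subTy, ih, liftTySub_subTy]

theorem liftTySub_var : liftTySub Ty.var = Ty.var := by
  funext n; cases n <;> rfl

theorem subTy_var (S : Ty) : subTy Ty.var S = S := by
  induction S with
  | var n => rfl
  | arrow a b iha ihb => simp [subTy, iha, ihb]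
  | all a ih => simp [subTy, ih, liftTySub_var]

theorem liftRen_id : liftRen id = id := by
  funext n; cases n <;> rfl

mutual
theorem renTm_renTm (ρx' ρk' ρa' ρx ρk ρa : Nat → Nat) : ∀ t,
    renTm ρx' ρk' ρa' (renTm ρx ρk ρa t) = renTm (ρx' ∘ ρx) (ρk' ∘ ρk) (ρa' ∘ ρa) t
  | .var n => by simp [renTm]
  | .lam S t => by simp [renTm, renTy_renTy, renTm_renTm, liftRen_comp]
  | .app a b => by simp [renTm, renTm_renTm]
  | .tlam t => by simp [renTm, renTm_renTm, liftRen_comp]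
  | .tapp t S => by simp [renTm, renTm_renTm, renTy_renTy]
  | .callcc t => by simp [renTm, renTm_renTm, liftRen_comp]
  | .throwVar k t => by simp [renTm, renTm_renTm]
  | .throwCtx E t => by simp [renTm, renTm_renTm, renCtx_renCtx]

theorem renCtx_renCtx (ρx' ρk' ρa' ρx ρk ρa : Nat → Nat) : ∀ E,
    renCtx ρx' ρk' ρa' (renCtx ρx ρk ρa E) = renCtx (ρx' ∘ ρx) (ρk' ∘ ρk) (ρa' ∘ ρa) E
  | .hole => by simp [renCtx]
  | .lamApp S t E => by simp [renCtx, renTy_renTy, renTm_renTm, renCtx_renCtx, liftRen_comp]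
  | .app E t => by simp [renCtx, renTm_renTm, renCtx_renCtx]
  | .tapp E S => by simp [renCtx, renCtx_renCtx, renTy_renTy]
  | .throw E0 E => by simp [renCtx, renCtx_renCtx]
end

theorem liftSubX_comp_ren (σ : Nat → Tm) (ρ : Nat → Nat) :
    liftSubX (σ ∘ ρ) = liftSubX σ ∘ liftRen ρ := by
  funext n; cases n <;> rfl

theorem liftSubK_comp_ren (σ : Nat → Ctx ⊕ Nat) (ρ : Nat → Nat) :
    liftSubK (σ ∘ ρ) = liftSubK σ ∘ liftRen ρ := by
  funext n; cases n <;> rfl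

theorem shiftSubXk_comp_ren (σ : Nat → Tm) (ρ : Nat → Nat) :
    shiftSubXk (σ ∘ ρ) = shiftSubXk σ ∘ ρ := rfl

theorem shiftSubXa_comp_ren (σ : Nat → Tm) (ρ : Nat → Nat) :
    shiftSubXa (σ ∘ ρ) = shiftSubXa σ ∘ ρ := rfl

theorem shiftSubKx_comp_ren (σ : Nat → Ctx ⊕ Nat) (ρ : Nat → Nat) :
    shiftSubKx (σ ∘ ρ) = shiftSubKx σ ∘ ρ := rfl

theorem shiftSubKa_comp_ren (σ : Nat → Ctx ⊕ Nat) (ρ : Nat → Nat) :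
    shiftSubKa (σ ∘ ρ) = shiftSubKa σ ∘ ρ := rfl

mutual
theorem subTm_renTm (σx : Nat → Tm) (σk : Nat → Ctx ⊕ Nat) (σa : Nat → Ty)
    (ρx ρk ρa : Nat → Nat) : ∀ t,
    subTm σx σk σa (renTm ρx ρk ρa t) = subTm (σx ∘ ρx) (σk ∘ ρk) (σa ∘ ρa) t
  | .var n => by simp [renTm, subTm]
  | .lam S t => by
      simp [renTm, subTm, subTy_renTy, subTm_renTm, liftSubX_comp_ren, shiftSubKx_comp_ren]
  | .app a b => by simp [renTm, subTm, subTm_renTm]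
  | .tlam t => by
      simp [renTm, subTm, subTm_renTm, liftTySub_comp_ren, shiftSubXa_comp_ren,
        shiftSubKa_comp_ren]
  | .tapp t S => by simp [renTm, subTm, subTm_renTm, subTy_renTy]
  | .callcc t => by
      simp [renTm, subTm, subTm_renTm, liftSubK_comp_ren, shiftSubXk_comp_ren]
  | .throwVar k t => by simp [renTm, subTm, subTm_renTm]
  | .throwCtx E t => by simp [renTm, subTm, subTm_renTm, subCtx_renCtx]

theorem subCtx_renCtx (σx : Nat → Tm) (σk : Nat → Ctx ⊕ Nat) (σa : Nat → Ty)
    (ρx ρk ρa : Nat → Nat) : ∀ E,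
    subCtx σx σk σa (renCtx ρx ρk ρa E) = subCtx (σx ∘ ρx) (σk ∘ ρk) (σa ∘ ρa) E
  | .hole => by simp [renCtx, subCtx]
  | .lamApp S t E => by
      simp [renCtx, subCtx, subTy_renTy, subTm_renTm, subCtx_renCtx, liftSubX_comp_ren,
        shiftSubKx_comp_ren]
  | .app E t => by simp [renCtx, subCtx, subTm_renTm, subCtx_renCtx]
  | .tapp E S => by simp [renCtx, subCtx, subCtx_renCtx, subTy_renTy]
  | .throw E0 E => by simp [renCtx, subCtx, subCtx_renCtx]
end

/-- Renaming of an entry of a continuation substitution. -/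
def renEnt (ρx ρk ρa : Nat → Nat) : Ctx ⊕ Nat → Ctx ⊕ Nat
  | .inl E => .inl (renCtx ρx ρk ρa E)
  | .inr n => .inr (ρk n)

section
variable (ρx ρk ρa : Nat → Nat) (σx : Nat → Tm) (σk : Nat → Ctx ⊕ Nat)

theorem liftSubX_renTm : liftSubX (fun n => renTm ρx ρk ρa (σx n)) =
    fun n => renTm (liftRen ρx) ρk ρa (liftSubX σx n) := by
  funext n
  cases n with
  | zero => rfl
  | succ n => simp only [liftSubX, renTm_renTm]; rfl

theorem shiftSubXk_renTm : shiftSubXk (fun n => renTm ρx ρk ρa (σx n)) =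
    fun n => renTm ρx (liftRen ρk) ρa (shiftSubXk σx n) := by
  funext n
  simp only [shiftSubXk, renTm_renTm]; rfl

theorem shiftSubXa_renTm : shiftSubXa (fun n => renTm ρx ρk ρa (σx n)) =
    fun n => renTm ρx ρk (liftRen ρa) (shiftSubXa σx n) := by
  funext n
  simp only [shiftSubXa, renTm_renTm]; rfl

theorem liftSubK_renEnt : liftSubK (fun n => renEnt ρx ρk ρa (σk n)) =
    fun n => renEnt ρx (liftRen ρk) ρa (liftSubK σk n) := by
  funext n
  cases n with
  | zero => rfl
  | succ n => cases h : σk n <;> simp [liftSubK, renEnt, h, renCtx_renCtx] <;> rfl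

theorem shiftSubKx_renEnt : shiftSubKx (fun n => renEnt ρx ρk ρa (σk n)) =
    fun n => renEnt (liftRen ρx) ρk ρa (shiftSubKx σk n) := by
  funext n
  cases h : σk n <;> simp [shiftSubKx, mapKEnt, renEnt, h, renCtx_renCtx]
  rfl

theorem shiftSubKa_renEnt : shiftSubKa (fun n => renEnt ρx ρk ρa (σk n)) =
    fun n => renEnt ρx ρk (liftRen ρa) (shiftSubKa σk n) := by
  funext n
  cases h : σk n <;> simp [shiftSubKa, mapKEnt, renEnt, h, renCtx_renCtx]
  rfl

end

mutual
theorem renTm_subTm (ρx ρk ρa : Nat → Nat) (σx : Nat → Tm) (σk : Nat → Ctx ⊕ Nat)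
    (σa : Nat → Ty) : ∀ t, renTm ρx ρk ρa (subTm σx σk σa t) =
      subTm (fun n => renTm ρx ρk ρa (σx n)) (fun n => renEnt ρx ρk ρa (σk n))
        (fun n => renTy ρa (σa n)) t
  | .var n => by simp [subTm]
  | .lam S t => by
      simp [renTm, subTm, renTy_subTy, renTm_subTm, liftSubX_renTm, shiftSubKx_renEnt]
  | .app a b => by simp [renTm, subTm, renTm_subTm]
  | .tlam t => by
      simp [renTm, subTm, renTm_subTm, liftTySub_renTy, shiftSubXa_renTm, shiftSubKa_renEnt]
  | .tapp t S => by simp [renTm, subTm, renTm_subTm, renTy_subTy]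
  | .callcc t => by simp [renTm, subTm, renTm_subTm, liftSubK_renEnt, shiftSubXk_renTm]
  | .throwVar k t => by
      cases h : σk k <;> simp [renTm, subTm, h, renEnt, renTm_subTm]
  | .throwCtx E t => by simp [renTm, subTm, renTm_subTm, renCtx_subCtx]

theorem renCtx_subCtx (ρx ρk ρa : Nat → Nat) (σx : Nat → Tm) (σk : Nat → Ctx ⊕ Nat)
    (σa : Nat → Ty) : ∀ E, renCtx ρx ρk ρa (subCtx σx σk σa E) =
      subCtx (fun n => renTm ρx ρk ρa (σx n)) (fun n => renEnt ρx ρk ρa (σk n))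
        (fun n => renTy ρa (σa n)) E
  | .hole => by simp [renCtx, subCtx]
  | .lamApp S t E => by
      simp [renCtx, subCtx, renTy_subTy, renTm_subTm, renCtx_subCtx, liftSubX_renTm,
        shiftSubKx_renEnt]
  | .app E t => by simp [renCtx, subCtx, renTm_subTm, renCtx_subCtx]
  | .tapp E S => by simp [renCtx, subCtx, renCtx_subCtx, renTy_subTy]
  | .throw E0 E => by simp [renCtx, subCtx, renCtx_subCtx]
end

/-- Substitution in an entry of a continuation substitution. -/
def subEnt (τx : Nat → Tm) (τk : Nat → Ctx ⊕ Nat) (τa : Nat → Ty) : Ctx ⊕ Nat → Ctx ⊕ Nat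
  | .inl E => .inl (subCtx τx τk τa E)
  | .inr n => τk n

theorem renEnt_succ_x : renEnt Nat.succ id id = mapKEnt (renCtx Nat.succ id id) := by
  funext e; cases e <;> rfl

theorem renEnt_succ_a : renEnt id id Nat.succ = mapKEnt (renCtx id id Nat.succ) := by
  funext e; cases e <;> rfl

theorem liftSubK_succ (σk : Nat → Ctx ⊕ Nat) (n : Nat) :
    liftSubK σk (n + 1) = renEnt id Nat.succ id (σk n) := by
  cases h : σk n <;> simp [liftSubK, renEnt, h]

theorem renTy_id (S : Ty) : renTy id S = S := by
  induction S with
  | var n => rfl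
  | arrow a b iha ihb => simp [renTy, iha, ihb]
  | all a ih => simp [renTy, ih, liftRen_id]

section
variable (τx : Nat → Tm) (τk : Nat → Ctx ⊕ Nat) (τa : Nat → Ty)
  (σx : Nat → Tm) (σk : Nat → Ctx ⊕ Nat)

theorem liftSubX_subTm : liftSubX (fun n => subTm τx τk τa (σx n)) =
    fun n => subTm (liftSubX τx) (shiftSubKx τk) τa (liftSubX σx n) := by
  funext n
  cases n with
  | zero => rfl
  | succ n =>
    simp only [liftSubX, renTm_subTm, subTm_renTm, renEnt_succ_x, renTy_id]; rfl

theorem shiftSubXk_subTm : shiftSubXk (fun n => subTm τx τk τa (σx n)) =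
    fun n => subTm (shiftSubXk τx) (liftSubK τk) τa (shiftSubXk σx n) := by
  funext n
  simp only [shiftSubXk, renTm_subTm, subTm_renTm, renTy_id, ← liftSubK_succ]; rfl

theorem shiftSubXa_subTm : shiftSubXa (fun n => subTm τx τk τa (σx n)) =
    fun n => subTm (shiftSubXa τx) (shiftSubKa τk) (liftTySub τa) (shiftSubXa σx n) := by
  funext n
  simp only [shiftSubXa, renTm_subTm, subTm_renTm, renEnt_succ_a]; rfl

theorem shiftSubKx_subEnt : shiftSubKx (fun n => subEnt τx τk τa (σk n)) =
    fun n => subEnt (liftSubX τx) (shiftSubKx τk) τa (shiftSubKx σk n) := by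
  funext n
  cases h : σk n with
  | inr m => simp [shiftSubKx, mapKEnt, subEnt, h]
  | inl E =>
    simp only [shiftSubKx, mapKEnt, subEnt, h, renCtx_subCtx, subCtx_renCtx, renEnt_succ_x,
      renTy_id]
    rfl

theorem liftSubK_subEnt : liftSubK (fun n => subEnt τx τk τa (σk n)) =
    fun n => subEnt (shiftSubXk τx) (liftSubK τk) τa (liftSubK σk n) := by
  funext n
  cases n with
  | zero => rfl
  | succ n =>
    cases h : σk n with
    | inr m => simp [liftSubK_succ, renEnt, subEnt, h]
    | inl E =>
      rw [liftSubK_succ]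
      simp only [liftSubK, subEnt, h, renEnt, renCtx_subCtx, subCtx_renCtx, renTy_id]
      rfl

theorem shiftSubKa_subEnt : shiftSubKa (fun n => subEnt τx τk τa (σk n)) =
    fun n => subEnt (shiftSubXa τx) (shiftSubKa τk) (liftTySub τa) (shiftSubKa σk n) := by
  funext n
  cases h : σk n with
  | inr m => simp [shiftSubKa, mapKEnt, subEnt, h]
  | inl E =>
    simp only [shiftSubKa, mapKEnt, subEnt, h, renCtx_subCtx, subCtx_renCtx, renEnt_succ_a]
    rfl

end

mutual
theorem subTm_subTm (τx : Nat → Tm) (τk : Nat → Ctx ⊕ Nat) (τa : Nat → Ty)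
    (σx : Nat → Tm) (σk : Nat → Ctx ⊕ Nat) (σa : Nat → Ty) : ∀ t,
    subTm τx τk τa (subTm σx σk σa t) =
      subTm (fun n => subTm τx τk τa (σx n)) (fun n => subEnt τx τk τa (σk n))
        (fun n => subTy τa (σa n)) t
  | .var n => by simp [subTm]
  | .lam S t => by
      simp [subTm, subTy_subTy, subTm_subTm, liftSubX_subTm, shiftSubKx_subEnt]
  | .app a b => by simp [subTm, subTm_subTm]
  | .tlam t => by
      simp [subTm, subTm_subTm, liftTySub_subTy, shiftSubXa_subTm, shiftSubKa_subEnt]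
  | .tapp t S => by simp [subTm, subTm_subTm, subTy_subTy]
  | .callcc t => by simp [subTm, subTm_subTm, liftSubK_subEnt, shiftSubXk_subTm]
  | .throwVar k t => by
      cases h : σk k <;> simp [subTm, h, subEnt, subTm_subTm]
  | .throwCtx E t => by simp [subTm, subTm_subTm, subCtx_subCtx]

theorem subCtx_subCtx (τx : Nat → Tm) (τk : Nat → Ctx ⊕ Nat) (τa : Nat → Ty)
    (σx : Nat → Tm) (σk : Nat → Ctx ⊕ Nat) (σa : Nat → Ty) : ∀ E,
    subCtx τx τk τa (subCtx σx σk σa E) =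
      subCtx (fun n => subTm τx τk τa (σx n)) (fun n => subEnt τx τk τa (σk n))
        (fun n => subTy τa (σa n)) E
  | .hole => by simp [subCtx]
  | .lamApp S t E => by
      simp [subCtx, subTy_subTy, subTm_subTm, subCtx_subCtx, liftSubX_subTm, shiftSubKx_subEnt]
  | .app E t => by simp [subCtx, subTm_subTm, subCtx_subCtx]
  | .tapp E S => by simp [subCtx, subCtx_subCtx, subTy_subTy]
  | .throw E0 E => by simp [subCtx, subCtx_subCtx]
end

theorem liftSubX_var : liftSubX Tm.var = Tm.var := by
  funext n; cases n <;> rfl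

theorem shiftSubXk_var : shiftSubXk Tm.var = Tm.var := rfl

theorem shiftSubXa_var : shiftSubXa Tm.var = Tm.var := rfl

theorem liftSubK_inr : liftSubK Sum.inr = Sum.inr := by
  funext n; cases n <;> rfl

theorem shiftSubKx_inr : shiftSubKx Sum.inr = Sum.inr := rfl

theorem shiftSubKa_inr : shiftSubKa Sum.inr = Sum.inr := rfl

mutual
theorem subTm_var : ∀ t, subTm Tm.var Sum.inr Ty.var t = t
  | .var n => by simp [subTm]
  | .lam S t => by simp [subTm, subTy_var, subTm_var, liftSubX_var, shiftSubKx_inr]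
  | .app a b => by simp [subTm, subTm_var]
  | .tlam t => by simp [subTm, subTm_var, liftTySub_var, shiftSubXa_var, shiftSubKa_inr]
  | .tapp t S => by simp [subTm, subTm_var, subTy_var]
  | .callcc t => by simp [subTm, subTm_var, liftSubK_inr, shiftSubXk_var]
  | .throwVar k t => by simp [subTm, subTm_var]
  | .throwCtx E t => by simp [subTm, subTm_var, subCtx_var]

theorem subCtx_var : ∀ E, subCtx Tm.var Sum.inr Ty.var E = E
  | .hole => by simp [subCtx]
  | .lamApp S t E => by
      simp [subCtx, subTy_var, subTm_var, subCtx_var, liftSubX_var, shiftSubKx_inr]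
  | .app E t => by simp [subCtx, subTm_var, subCtx_var]
  | .tapp E S => by simp [subCtx, subCtx_var, subTy_var]
  | .throw E0 E => by simp [subCtx, subCtx_var]
end

/-- Extension of an environment by a new entry at index `0`. -/
def scons {α : Type*} (a : α) (f : Nat → α) : Nat → α
  | 0 => a
  | n+1 => f n

section
variable (σx : Nat → Tm) (σk : Nat → Ctx ⊕ Nat) (σa : Nat → Ty) (t : Tm)

theorem sub0X_subTm (v : Tm) :
    sub0X v (subTm (liftSubX σx) (shiftSubKx σk) σa t) = subTm (scons v σx) σk σa t := by
  rw [sub0X, subTm_subTm]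
  congr 1
  · funext n
    cases n with
    | zero => rfl
    | succ n => simp only [liftSubX, subTm_renTm]; exact subTm_var _
  · funext n
    cases h : σk n with
    | inr m => simp [shiftSubKx, mapKEnt, subEnt, h]
    | inl E =>
      simp only [shiftSubKx, mapKEnt, subEnt, h, subCtx_renCtx]
      exact congrArg Sum.inl (subCtx_var E)
  · funext n; exact subTy_var _

theorem sub0K_subTm (E : Ctx) :
    sub0K E (subTm (shiftSubXk σx) (liftSubK σk) σa t) =
      subTm σx (scons (.inl E) σk) σa t := by
  rw [sub0K, subTm_subTm]
  congr 1
  · funext n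
    simp only [shiftSubXk, subTm_renTm]; exact subTm_var _
  · funext n
    cases n with
    | zero => rfl
    | succ n =>
      cases h : σk n with
      | inr m => simp [liftSubK_succ, renEnt, subEnt, scons, h]
      | inl E =>
        simp only [liftSubK_succ, renEnt, subEnt, scons, h, subCtx_renCtx]
        exact congrArg Sum.inl (subCtx_var E)
  · funext n; exact subTy_var _

theorem sub0A_subTm (S : Ty) :
    sub0A S (subTm (shiftSubXa σx) (shiftSubKa σk) (liftTySub σa) t) =
      subTm σx σk (scons S σa) t := by
  rw [sub0A, subTm_subTm]
  congr 1
  · funext n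
    simp only [shiftSubXa, subTm_renTm]; exact subTm_var _
  · funext n
    cases h : σk n with
    | inr m => simp [shiftSubKa, mapKEnt, subEnt, h]
    | inl E =>
      simp only [shiftSubKa, mapKEnt, subEnt, h, subCtx_renCtx]
      exact congrArg Sum.inl (subCtx_var E)
  · funext n
    cases n with
    | zero => rfl
    | succ n => simp only [liftTySub, subTy_renTy]; exact subTy_var _

end

/-! ### Untyped parametric reducibility -/

/-- Interpretation of a type as a set of values, where `δ` interprets the type variables by
arbitrary sets of values. No typing or closedness is recorded: it is not needed for termination. -/
def Val : Ty → (Nat → Set Tm) → Set Tm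
  | .var i, δ => δ i
  | .arrow S T, δ =>
      {v | ∃ U b, v = .lam U b ∧ ∀ w ∈ Val S δ, ∀ E, CtxOK (Val T δ) E →
        Norm (plug (.app v w) E)}
  | .all S, δ =>
      {v | IsValue v ∧ ∀ (U : Ty) (R : Set Tm), (∀ w ∈ R, IsValue w) →
        ∀ E, CtxOK (Val S (scons R δ)) E → Norm (plug (.tapp v U) E)}

theorem isValue_of_mem_Val {S : Ty} {δ : Nat → Set Tm} (hδ : ∀ i, ∀ v ∈ δ i, IsValue v)
    {v : Tm} (hv : v ∈ Val S δ) : IsValue v := by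
  cases S with
  | var i => exact hδ i v hv
  | arrow S T => obtain ⟨U, b, rfl, -⟩ := hv; exact .lam
  | all S => exact hv.1

theorem scons_comp_liftRen {α : Type*} (a : α) (f : Nat → α) (ρ : Nat → Nat) :
    scons a f ∘ liftRen ρ = scons a (f ∘ ρ) := by
  funext n; cases n <;> rfl

theorem Val_renTy (S : Ty) : ∀ ρ δ, Val (renTy ρ S) δ = Val S (δ ∘ ρ) := by
  induction S with
  | var n => intros; rfl
  | arrow a b iha ihb => intros; simp only [renTy, Val, iha, ihb]
  | all a ih => intros; simp only [renTy, Val, ih, scons_comp_liftRen]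

theorem Val_liftTySub (σ : Nat → Ty) (R : Set Tm) (δ : Nat → Set Tm) :
    (fun i => Val (liftTySub σ i) (scons R δ)) = scons R (fun i => Val (σ i) δ) := by
  funext n
  cases n with
  | zero => rfl
  | succ n => simp only [liftTySub, Val_renTy]; rfl

theorem Val_subTy (S : Ty) : ∀ σ δ, Val (subTy σ S) δ = Val S (fun i => Val (σ i) δ) := by
  induction S with
  | var n => intros; rfl
  | arrow a b iha ihb => intros; simp only [subTy, Val, iha, ihb]
  | all a ih => intros; simp only [subTy, Val, ih, Val_liftTySub]

theorem Val_subTy0 (T S : Ty) (δ : Nat → Set Tm) :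
    Val (subTy0 T S) δ = Val S (scons (Val T δ) δ) := by
  rw [subTy0, Val_subTy]
  congr 1
  funext n; cases n <;> rfl

theorem Norm.of_step {p q : Tm} (h : Step p q) : Norm q → Norm p
  | ⟨v, hv, hs⟩ => ⟨v, hv, .head h hs⟩

/-- Fundamental property: a plain well-typed term, closed by reducible values and contexts,
normalizes in every context that normalizes on reducible values. -/
theorem norm_plug_subTm {t : Tm} (ht : Plain t) :
    ∀ {Γ Δ : List Ty} {S : Ty}, HasTy Γ Δ t S →
    ∀ (δ : Nat → Set Tm), (∀ i, ∀ v ∈ δ i, IsValue v) →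
    ∀ (σx : Nat → Tm) (σk : Nat → Ctx ⊕ Nat) (σa : Nat → Ty),
    (∀ n T, Γ[n]? = some T → σx n ∈ Val T δ) →
    (∀ n T, Δ[n]? = some T → ∃ E, σk n = .inl E ∧ CtxOK (Val T δ) E) →
    ∀ E, CtxOK (Val S δ) E → Norm (plug (subTm σx σk σa t) E) := by
  induction ht with
  | var =>
    intro Γ Δ S h δ hδ σx σk σa hx hk E hE
    cases h with
    | var h => exact hE _ (hx _ _ h)
  | lam _ ih =>
    intro Γ Δ S h δ hδ σx σk σa hx hk E hE
    cases h with
    | lam h =>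
      refine hE _ ⟨_, _, rfl, fun w hw E' hE' => ?_⟩
      refine Norm.of_step (.beta (isValue_of_mem_Val hδ hw)) ?_
      rw [sub0X_subTm]
      refine ih h δ hδ _ _ _ (fun n T hn => ?_) hk E' hE'
      cases n with
      | zero => cases hn; exact hw
      | succ n => exact hx n T hn
  | app _ _ iha ihb =>
    intro Γ Δ S h δ hδ σx σk σa hx hk E hE
    cases h with
    | app ha hb =>
      refine iha ha δ hδ σx σk σa hx hk (.app E _) ?_
      rintro v ⟨U, b, rfl, hv⟩
      exact ihb hb δ hδ σx σk σa hx hk (.lamApp U b E) fun w hw => hv w hw E hE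
  | tlam _ ih =>
    intro Γ Δ S h δ hδ σx σk σa hx hk E hE
    cases h with
    | tlam h =>
      refine hE _ ⟨.tlam, fun U R hR E' hE' => ?_⟩
      refine Norm.of_step .betaT ?_
      rw [sub0A_subTm]
      refine ih h (scons R δ) ?_ _ _ _ (fun n T hn => ?_) (fun n T hn => ?_) E' hE'
      · rintro (_ | i)
        exacts [hR, hδ i]
      · obtain ⟨T, hT, rfl⟩ := by simpa using hn
        rw [Val_renTy]
        exact hx n T hT
      · obtain ⟨T, hT, rfl⟩ := by simpa using hn
        rw [Val_renTy]
        exact hk n T hT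
  | tapp _ ih =>
    intro Γ Δ S h δ hδ σx σk σa hx hk E hE
    cases h with
    | tapp h =>
      refine ih h δ hδ σx σk σa hx hk (.tapp E _) fun v hv => ?_
      rw [Val_subTy0] at hE
      exact hv.2 _ _ (fun w hw => isValue_of_mem_Val hδ hw) E hE
  | callcc _ ih =>
    intro Γ Δ S h δ hδ σx σk σa hx hk E hE
    cases h with
    | callcc h =>
      refine Norm.of_step .callcc ?_
      rw [sub0K_subTm]
      refine ih h δ hδ _ _ _ hx (fun n T hn => ?_) E hE
      cases n with
      | zero => cases hn; exact ⟨E, rfl, hE⟩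
      | succ n => exact hk n T hn
  | @throwVar k t _ ih =>
    intro Γ Δ S h δ hδ σx σk σa hx hk E hE
    cases h with
    | throwVar hΔ h =>
      obtain ⟨E0, hE0, hok⟩ := hk _ _ hΔ
      simp only [subTm, hE0]
      exact ih h δ hδ σx σk σa hx hk (.throw E0 E) fun v hv =>
        Norm.of_step (.throw (isValue_of_mem_Val hδ hv)) (hok v hv)

/-- **Termination of call-by-value evaluation in `λFv`** (Theorem 3).
If `p` is a well-typed program (a closed plain term typable in the empty
environments), then the call-by-value evaluation of `p` terminates: there
exists a value `v` such that `p →v* v`. -/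
theorem termination_cbv
    (p : Tm) (hclosed : ClosedTm p) (hplain : Plain p)
    (htyped : ∃ S, HasTy ([] : List Ty) ([] : List Ty) p S) :
    ∃ v, IsValue v ∧ Steps p v := by
  obtain ⟨S, h⟩ := htyped
  have hn := norm_plug_subTm hplain h (fun _ => ∅) (by simp) Tm.var Sum.inr Ty.var
    (by simp) (by simp) .hole
    fun v hv => ⟨v, isValue_of_mem_Val (by simp) hv, .refl⟩
  rwa [subTm_var] at hn

end LambdaFv
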